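/- arXiv:2206.01657 — 2 statements merged into one kernel-verified Lean document; each statement's English description precedes it below -/
import Mathlib

section
/- Let σ_1,…,σ_k ∈ ℂ be such that K(σ_j) and K̂(σ_j) = Wᴴ K(σ_j) V are invertible for all j = 1,…,k, let b ∈ ℂ^m be a tangential direction, and let d^{(1)},…,d^{(k-1)} ∈ ℂ^m be scaling vectors. Define recursively v_1 = K(σ_1)^{-1} B(σ_1) b and v_j = K(σ_j)^{-1} 𝔑(σ_{j-1}, d^{(j-1)}) v_{j-1} for 2 ≤ j ≤ k. If v_1,…,v_k all lie in the column space of V, then for every 1 ≤ q ≤ k the right tangential interpolation conditions 𝔾_q(σ_1,…,σ_q | d^{(1)},…,d^{(q-1)}) b = 𝔾̂_q(σ_1,…,σ_q | d^{(1)},…,d^{(q-1)}) b hold. -/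
open Matrix
open scoped Kronecker

namespace StructBilin

/-- Scaled sum of the bilinear terms: `𝔑(s, d) = ∑ i, d i • N i s`. -/
noncomputable def Nsum {n m : ℕ} (N : Fin m → ℂ → Matrix (Fin n) (Fin n) ℂ) (s : ℂ)
    (d : Fin m → ℂ) : Matrix (Fin n) (Fin n) ℂ :=
  ∑ i, d i • N i s

/-- Middle factor of the modified transfer function
`𝔾_{q+1}(σ 0, …, σ q | d 0, …, d (q-1)) = C (σ q) * gAux K B N σ d q`. -/
noncomputable def gAux {n m : ℕ} (K : ℂ → Matrix (Fin n) (Fin n) ℂ)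
    (B : ℂ → Matrix (Fin n) (Fin m) ℂ) (N : Fin m → ℂ → Matrix (Fin n) (Fin n) ℂ)
    (σ : ℕ → ℂ) (d : ℕ → Fin m → ℂ) : ℕ → Matrix (Fin n) (Fin m) ℂ
  | 0 => (K (σ 0))⁻¹ * B (σ 0)
  | j + 1 => (K (σ (j + 1)))⁻¹ * Nsum N (σ j) (d j) * gAux K B N σ d j

/-- The modified (scaled and summed) transfer function
`𝔾_{q+1}(σ 0, …, σ q | d 0, …, d (q-1))` (the level is `q + 1`, indices are 0-based). -/
noncomputable def Gmod {n m p : ℕ} (C : ℂ → Matrix (Fin p) (Fin n) ℂ)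
    (K : ℂ → Matrix (Fin n) (Fin n) ℂ) (B : ℂ → Matrix (Fin n) (Fin m) ℂ)
    (N : Fin m → ℂ → Matrix (Fin n) (Fin n) ℂ) (σ : ℕ → ℂ) (d : ℕ → Fin m → ℂ)
    (q : ℕ) : Matrix (Fin p) (Fin m) ℂ :=
  C (σ q) * gAux K B N σ d q

/-- Right tangential interpolation vectors:
`v 0 = K(σ 0)⁻¹ B(σ 0) b`, `v (j+1) = K(σ (j+1))⁻¹ 𝔑(σ j, d j) v j`. -/
noncomputable def vtan {n m : ℕ} (K : ℂ → Matrix (Fin n) (Fin n) ℂ)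
    (B : ℂ → Matrix (Fin n) (Fin m) ℂ) (N : Fin m → ℂ → Matrix (Fin n) (Fin n) ℂ)
    (σ : ℕ → ℂ) (d : ℕ → Fin m → ℂ) (b : Fin m → ℂ) : ℕ → Fin n → ℂ
  | 0 => (K (σ 0))⁻¹ *ᵥ (B (σ 0) *ᵥ b)
  | j + 1 => (K (σ (j + 1)))⁻¹ *ᵥ (Nsum N (σ j) (d j) *ᵥ vtan K B N σ d b j)

/-- Left tangential interpolation vectors (with reversed point sequence `τ` and
scaling sequence `e`):
`w 0 = K(τ 0)^{-ᴴ} C(τ 0)ᴴ c`, `w (t+1) = K(τ (t+1))^{-ᴴ} 𝔑(τ (t+1), e t)ᴴ w t`. -/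
noncomputable def wtan {n m p : ℕ} (C : ℂ → Matrix (Fin p) (Fin n) ℂ)
    (K : ℂ → Matrix (Fin n) (Fin n) ℂ) (N : Fin m → ℂ → Matrix (Fin n) (Fin n) ℂ)
    (τ : ℕ → ℂ) (e : ℕ → Fin m → ℂ) (c : Fin p → ℂ) : ℕ → Fin n → ℂ
  | 0 => ((K (τ 0))⁻¹)ᴴ *ᵥ ((C (τ 0))ᴴ *ᵥ c)
  | t + 1 => ((K (τ (t + 1)))⁻¹)ᴴ *ᵥ ((Nsum N (τ (t + 1)) (e t))ᴴ *ᵥ wtan C K N τ e c t)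

/-- Entrywise `t`-th complex derivative of a matrix-valued function. -/
noncomputable def mDeriv {α β : Type*} (t : ℕ) (f : ℂ → Matrix α β ℂ) (z : ℂ) :
    Matrix α β ℂ :=
  Matrix.of fun i j => iteratedDeriv t (fun w => f w i j) z

/-- Entrywise `t`-th complex derivative of a vector-valued function. -/
noncomputable def vDeriv {α : Type*} (t : ℕ) (f : ℂ → α → ℂ) (z : ℂ) : α → ℂ :=
  fun i => iteratedDeriv t (fun w => f w i) z

/-- Partial derivative in the `i`-th coordinate of a function of countably many
complex variables. -/
noncomputable def pD (i : ℕ) (f : (ℕ → ℂ) → ℂ) (s : ℕ → ℂ) : ℂ :=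
  deriv (fun z => f (Function.update s i z)) (s i)

/-- Mixed partial derivative `∂_{s_1^{ord 0} ⋯ s_t^{ord (t-1)}}` of a function of the
first `t` coordinates. -/
noncomputable def mixedD (ord : ℕ → ℕ) : ℕ → ((ℕ → ℂ) → ℂ) → (ℕ → ℂ) → ℂ
  | 0, f => f
  | t + 1, f => mixedD ord t ((pD t)^[ord t] f)

/-- The Hermite chain
`hChain t = ∂^{ℓ (t)}(𝔑(·, d t) K⁻¹)(σ t) ⋯ ∂^{ℓ 0}(𝔑(·, d 0) K⁻¹ B)(σ 0)`. -/
noncomputable def hChain {n m : ℕ} (K : ℂ → Matrix (Fin n) (Fin n) ℂ)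
    (B : ℂ → Matrix (Fin n) (Fin m) ℂ) (N : Fin m → ℂ → Matrix (Fin n) (Fin n) ℂ)
    (σ : ℕ → ℂ) (d : ℕ → Fin m → ℂ) (ℓ : ℕ → ℕ) : ℕ → Matrix (Fin n) (Fin m) ℂ
  | 0 => mDeriv (ℓ 0) (fun z => Nsum N z (d 0) * ((K z)⁻¹ * B z)) (σ 0)
  | t + 1 =>
      mDeriv (ℓ (t + 1)) (fun z => Nsum N z (d (t + 1)) * (K z)⁻¹) (σ (t + 1)) *
        hChain K B N σ d ℓ t

/-- Right tangential Hermite interpolation vectors. -/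
noncomputable def vHerm {n m : ℕ} (K : ℂ → Matrix (Fin n) (Fin n) ℂ)
    (B : ℂ → Matrix (Fin n) (Fin m) ℂ) (N : Fin m → ℂ → Matrix (Fin n) (Fin n) ℂ)
    (σ : ℕ → ℂ) (d : ℕ → Fin m → ℂ) (ℓ : ℕ → ℕ) (b : Fin m → ℂ) : ℕ → ℕ → Fin n → ℂ
  | 0, j => mDeriv j (fun z => (K z)⁻¹ * B z) (σ 0) *ᵥ b
  | t + 1, j => (mDeriv j (fun z => (K z)⁻¹) (σ (t + 1)) * hChain K B N σ d ℓ t) *ᵥ b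

/-- Left tangential Hermite interpolation vectors (with reversed sequences). -/
noncomputable def wHerm {n m p : ℕ} (C : ℂ → Matrix (Fin p) (Fin n) ℂ)
    (K : ℂ → Matrix (Fin n) (Fin n) ℂ) (N : Fin m → ℂ → Matrix (Fin n) (Fin n) ℂ)
    (τ : ℕ → ℂ) (e : ℕ → Fin m → ℂ) (eν : ℕ → ℕ) (c : Fin p → ℂ) : ℕ → ℕ → Fin n → ℂ
  | 0, i => star (vDeriv i (fun z => Matrix.vecMul (star c) (C z * (K z)⁻¹)) (τ 0))
  | t + 1, j =>
      star (vDeriv j (fun z =>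
        Matrix.vecMul (star (wHerm C K N τ e eν c t (eν t))) (Nsum N z (e t) * (K z)⁻¹))
        (τ (t + 1)))

/-- Column index type of the `j+1`-st subsystem transfer function (`m^(j+1)` indices). -/
def colT (m : ℕ) : ℕ → Type
  | 0 => Fin m
  | j + 1 => Fin m × colT m j

def colTFintype (m : ℕ) : ∀ j, Fintype (colT m j)
  | 0 => inferInstanceAs (Fintype (Fin m))
  | j + 1 => letI := colTFintype m j; inferInstanceAs (Fintype (Fin m × colT m j))

attribute [instance] colTFintype

/-- Block index type (`m^j` indices). -/
def outT (m : ℕ) : ℕ → Type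
  | 0 => Fin 1
  | j + 1 => Fin m × outT m j

def outTFintype (m : ℕ) : ∀ j, Fintype (outT m j)
  | 0 => inferInstanceAs (Fintype (Fin 1))
  | j + 1 => letI := outTFintype m j; inferInstanceAs (Fintype (Fin m × outT m j))

attribute [instance] outTFintype

/-- The horizontal concatenation `N(s) = [N_1(s) ⋯ N_m(s)]`. -/
noncomputable def Nbig {n m : ℕ} (N : Fin m → ℂ → Matrix (Fin n) (Fin n) ℂ) (s : ℂ) :
    Matrix (Fin n) (Fin m × Fin n) ℂ :=
  Matrix.of fun i q => N q.1 s i q.2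

/-- The vertical concatenation `Ñ(s)` of `N_1(s), …, N_m(s)`. -/
noncomputable def Ntil {n m : ℕ} (N : Fin m → ℂ → Matrix (Fin n) (Fin n) ℂ) (s : ℂ) :
    Matrix (Fin m × Fin n) (Fin n) ℂ :=
  Matrix.of fun q i => N q.1 s q.2 i

/-- State part of the `j+1`-st subsystem transfer function:
`Z 0 = K(σ 0)⁻¹ B(σ 0)`, `Z (j+1) = K(σ (j+1))⁻¹ N(σ j) (I_m ⊗ Z j)`. -/
noncomputable def Zblk {n m : ℕ} (K : ℂ → Matrix (Fin n) (Fin n) ℂ)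
    (B : ℂ → Matrix (Fin n) (Fin m) ℂ) (N : Fin m → ℂ → Matrix (Fin n) (Fin n) ℂ)
    (σ : ℕ → ℂ) : (j : ℕ) → Matrix (Fin n) (colT m j) ℂ
  | 0 => (K (σ 0))⁻¹ * B (σ 0)
  | j + 1 =>
      (K (σ (j + 1)))⁻¹ * Nbig N (σ j) *
        ((1 : Matrix (Fin m) (Fin m) ℂ) ⊗ₖ Zblk K B N σ j)

/-- The `q+1`-st subsystem transfer function `G_{q+1}(σ 0, …, σ q)`. -/
noncomputable def Gblk {n m p : ℕ} (C : ℂ → Matrix (Fin p) (Fin n) ℂ)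
    (K : ℂ → Matrix (Fin n) (Fin n) ℂ) (B : ℂ → Matrix (Fin n) (Fin m) ℂ)
    (N : Fin m → ℂ → Matrix (Fin n) (Fin n) ℂ) (σ : ℕ → ℂ) (q : ℕ) :
    Matrix (Fin p) (colT m q) ℂ :=
  C (σ q) * Zblk K B N σ q

/-- The tangential direction matrix `I_{m^j} ⊗ b`. -/
noncomputable def tangMat {m : ℕ} (b : Fin m → ℂ) :
    (j : ℕ) → Matrix (colT m j) (outT m j) ℂ
  | 0 => Matrix.of fun i _ => b i
  | j + 1 => (1 : Matrix (Fin m) (Fin m) ℂ) ⊗ₖ tangMat b j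

/-- Blockwise right interpolation matrices:
`V 0 = K(σ 0)⁻¹ B(σ 0) b`, `V (j+1) = K(σ (j+1))⁻¹ N(σ j) (I_m ⊗ V j)`. -/
noncomputable def Vblk {n m : ℕ} (K : ℂ → Matrix (Fin n) (Fin n) ℂ)
    (B : ℂ → Matrix (Fin n) (Fin m) ℂ) (N : Fin m → ℂ → Matrix (Fin n) (Fin n) ℂ)
    (σ : ℕ → ℂ) (b : Fin m → ℂ) : (j : ℕ) → Matrix (Fin n) (outT m j) ℂ
  | 0 => Matrix.of fun i _ => ((K (σ 0))⁻¹ *ᵥ (B (σ 0) *ᵥ b)) i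
  | j + 1 =>
      (K (σ (j + 1)))⁻¹ * Nbig N (σ j) *
        ((1 : Matrix (Fin m) (Fin m) ℂ) ⊗ₖ Vblk K B N σ b j)

/-- Blockwise left interpolation matrices (with reversed point sequence `τ`):
`W 0 = K(τ 0)^{-ᴴ} C(τ 0)ᴴ c`, `W (t+1) = K(τ (t+1))^{-ᴴ} Ñ(τ (t+1))ᴴ (I_m ⊗ W t)`. -/
noncomputable def Wblk {n m p : ℕ} (C : ℂ → Matrix (Fin p) (Fin n) ℂ)
    (K : ℂ → Matrix (Fin n) (Fin n) ℂ) (N : Fin m → ℂ → Matrix (Fin n) (Fin n) ℂ)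
    (τ : ℕ → ℂ) (c : Fin p → ℂ) : (t : ℕ) → Matrix (Fin n) (outT m t) ℂ
  | 0 => Matrix.of fun i _ => (((K (τ 0))⁻¹)ᴴ *ᵥ ((C (τ 0))ᴴ *ᵥ c)) i
  | t + 1 =>
      ((K (τ (t + 1)))⁻¹)ᴴ * (Ntil N (τ (t + 1)))ᴴ *
        ((1 : Matrix (Fin m) (Fin m) ℂ) ⊗ₖ Wblk C K N τ c t)

/-- A vector as a one-column matrix. -/
noncomputable def bCol {m : ℕ} (b : Fin m → ℂ) : Matrix (Fin m) (Fin 1) ℂ :=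
  Matrix.of fun i _ => b i

/-- Blockwise Hermite chain. -/
noncomputable def hChainB {n m : ℕ} (K : ℂ → Matrix (Fin n) (Fin n) ℂ)
    (B : ℂ → Matrix (Fin n) (Fin m) ℂ) (N : Fin m → ℂ → Matrix (Fin n) (Fin n) ℂ)
    (σ : ℕ → ℂ) (ℓ : ℕ → ℕ) (b : Fin m → ℂ) :
    (t : ℕ) → Matrix (Fin n) (outT m (t + 1)) ℂ
  | 0 => mDeriv (ℓ 0)
      (fun z => Nbig N z * ((1 : Matrix (Fin m) (Fin m) ℂ) ⊗ₖ ((K z)⁻¹ * B z * bCol b)))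
      (σ 0)
  | t + 1 =>
      mDeriv (ℓ (t + 1))
        (fun z => Nbig N z * ((1 : Matrix (Fin m) (Fin m) ℂ) ⊗ₖ (K z)⁻¹)) (σ (t + 1)) *
        ((1 : Matrix (Fin m) (Fin m) ℂ) ⊗ₖ hChainB K B N σ ℓ b t)

/-- Blockwise right Hermite interpolation matrices. -/
noncomputable def vHermB {n m : ℕ} (K : ℂ → Matrix (Fin n) (Fin n) ℂ)
    (B : ℂ → Matrix (Fin n) (Fin m) ℂ) (N : Fin m → ℂ → Matrix (Fin n) (Fin n) ℂ)
    (σ : ℕ → ℂ) (ℓ : ℕ → ℕ) (b : Fin m → ℂ) : (t : ℕ) → ℕ → Matrix (Fin n) (outT m t) ℂ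
  | 0, j => mDeriv j (fun z => (K z)⁻¹ * B z * bCol b) (σ 0)
  | t + 1, j => mDeriv j (fun z => (K z)⁻¹) (σ (t + 1)) * hChainB K B N σ ℓ b t

/-- Blockwise left Hermite interpolation matrices (with reversed sequences). -/
noncomputable def wHermB {n m p : ℕ} (C : ℂ → Matrix (Fin p) (Fin n) ℂ)
    (K : ℂ → Matrix (Fin n) (Fin n) ℂ) (N : Fin m → ℂ → Matrix (Fin n) (Fin n) ℂ)
    (τ : ℕ → ℂ) (eν : ℕ → ℕ) (c : Fin p → ℂ) : (t : ℕ) → ℕ → Matrix (Fin n) (outT m t) ℂ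
  | 0, i => Matrix.of fun idx _ =>
      star (iteratedDeriv i (fun z => Matrix.vecMul (star c) (C z * (K z)⁻¹) idx) (τ 0))
  | t + 1, j => Matrix.of fun idx cc =>
      star (iteratedDeriv j (fun z =>
        (((1 : Matrix (Fin m) (Fin m) ℂ) ⊗ₖ wHermB C K N τ eν c t (eν t))ᴴ * Ntil N z *
          (K z)⁻¹) cc idx) (τ (t + 1)))

/-- The Kronecker product `d (j-1) ⊗ ⋯ ⊗ d 0 ⊗ I_m` of scaling vectors with the identity. -/
noncomputable def dKron {m : ℕ} (d : ℕ → Fin m → ℂ) :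
    (j : ℕ) → Matrix (colT m j) (Fin m) ℂ
  | 0 => (1 : Matrix (Fin m) (Fin m) ℂ)
  | j + 1 => Matrix.of fun (pq : Fin m × colT m j) cix => d j pq.1 * dKron d j pq.2 cix

/-- The innermost (input) coordinate of a column multi-index. -/
def innerIdx (m : ℕ) : (j : ℕ) → colT m j → Fin m
  | 0 => fun x => x
  | j + 1 => fun (pq : Fin m × colT m j) => innerIdx m j pq.2

/-- The chain `K(σ t)⁻¹ N_{J (t-1)}(σ (t-1)) ⋯ N_{J 0}(σ 0) K(σ 0)⁻¹ B(σ 0)`. -/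
noncomputable def eChain {n m : ℕ} (K : ℂ → Matrix (Fin n) (Fin n) ℂ)
    (B : ℂ → Matrix (Fin n) (Fin m) ℂ) (N : Fin m → ℂ → Matrix (Fin n) (Fin n) ℂ)
    (σ : ℕ → ℂ) (J : ℕ → Fin m) : ℕ → Matrix (Fin n) (Fin m) ℂ
  | 0 => (K (σ 0))⁻¹ * B (σ 0)
  | t + 1 => (K (σ (t + 1)))⁻¹ * N (J t) (σ t) * eChain K B N σ J t

theorem gAux_mulVec {n m : ℕ} (K : ℂ → Matrix (Fin n) (Fin n) ℂ)
    (B : ℂ → Matrix (Fin n) (Fin m) ℂ) (N : Fin m → ℂ → Matrix (Fin n) (Fin n) ℂ)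
    (σ : ℕ → ℂ) (d : ℕ → Fin m → ℂ) (b : Fin m → ℂ) (j : ℕ) :
    gAux K B N σ d j *ᵥ b = vtan K B N σ d b j := by
  induction j with
  | zero => simp [gAux, vtan, Matrix.mulVec_mulVec]
  | succ j ih =>
    rw [gAux, vtan, ← ih, Matrix.mulVec_mulVec, Matrix.mulVec_mulVec, Matrix.mul_assoc]

theorem Nsum_projection {n m r : ℕ} (N : Fin m → ℂ → Matrix (Fin n) (Fin n) ℂ)
    (V W : Matrix (Fin n) (Fin r) ℂ) (s : ℂ) (d : Fin m → ℂ) :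
    Nsum (fun ι s => Wᴴ * N ι s * V) s d = Wᴴ * Nsum N s d * V := by
  simp [Nsum, Matrix.mul_sum, Matrix.sum_mul]

/-- A Petrov-Galerkin projection reproduces every solution lying in the range of `V`. -/
theorem mulVec_projected_solution {n r : ℕ} (A : Matrix (Fin n) (Fin n) ℂ)
    (V W : Matrix (Fin n) (Fin r) ℂ) (hA : IsUnit A.det) (hAr : IsUnit (Wᴴ * A * V).det)
    (x : Fin n → ℂ) (hx : A⁻¹ *ᵥ x ∈ Set.range V.mulVec) :
    V *ᵥ ((Wᴴ * A * V)⁻¹ *ᵥ (Wᴴ *ᵥ x)) = A⁻¹ *ᵥ x := by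
  obtain ⟨y, hy⟩ := hx
  have hxy : x = A *ᵥ (V *ᵥ y) := by
    rw [hy, Matrix.mulVec_mulVec, Matrix.mul_nonsing_inv _ hA, Matrix.one_mulVec]
  have hWx : Wᴴ *ᵥ x = (Wᴴ * A * V) *ᵥ y := by
    rw [hxy, Matrix.mulVec_mulVec, Matrix.mulVec_mulVec, Matrix.mul_assoc]
  rw [hWx, Matrix.mulVec_mulVec y, Matrix.nonsing_inv_mul _ hAr, Matrix.one_mulVec, ← hy]

theorem mulVec_vtan_projection {n m r : ℕ} (K : ℂ → Matrix (Fin n) (Fin n) ℂ)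
    (B : ℂ → Matrix (Fin n) (Fin m) ℂ) (N : Fin m → ℂ → Matrix (Fin n) (Fin n) ℂ)
    (V W : Matrix (Fin n) (Fin r) ℂ) (k : ℕ) (σ : ℕ → ℂ) (d : ℕ → Fin m → ℂ) (b : Fin m → ℂ)
    (hK : ∀ j < k, IsUnit (K (σ j)).det)
    (hKr : ∀ j < k, IsUnit (Wᴴ * K (σ j) * V).det)
    (hV : ∀ j < k, vtan K B N σ d b j ∈ Set.range V.mulVec) (j : ℕ) (hj : j < k) :
    V *ᵥ vtan (fun s => Wᴴ * K s * V) (fun s => Wᴴ * B s) (fun ι s => Wᴴ * N ι s * V) σ d b j =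
      vtan K B N σ d b j := by
  induction j with
  | zero =>
    simp only [vtan, ← Matrix.mulVec_mulVec b Wᴴ]
    exact mulVec_projected_solution _ V W (hK 0 hj) (hKr 0 hj) _ (hV 0 hj)
  | succ j ih =>
    rw [vtan, vtan, Nsum_projection, ← Matrix.mulVec_mulVec, ih (by omega),
      ← Matrix.mulVec_mulVec]
    exact mulVec_projected_solution _ V W (hK _ hj) (hKr _ hj) _ (hV _ hj)

theorem stmt_0 {n m p r : ℕ} (hn : 0 < n) (hm : 0 < m) (hp : 0 < p) (hr : 0 < r)
    (C : ℂ → Matrix (Fin p) (Fin n) ℂ) (K : ℂ → Matrix (Fin n) (Fin n) ℂ)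
    (B : ℂ → Matrix (Fin n) (Fin m) ℂ) (N : Fin m → ℂ → Matrix (Fin n) (Fin n) ℂ)
    (V W : Matrix (Fin n) (Fin r) ℂ)
    (k : ℕ) (hk : 0 < k) (σ : ℕ → ℂ) (d : ℕ → Fin m → ℂ) (b : Fin m → ℂ)
    (hK : ∀ j < k, IsUnit (K (σ j)).det)
    (hKr : ∀ j < k, IsUnit (Wᴴ * K (σ j) * V).det)
    (hV : ∀ j < k, vtan K B N σ d b j ∈ Set.range V.mulVec) :
    ∀ q < k,
      Gmod C K B N σ d q *ᵥ b =
        Gmod (fun s => C s * V) (fun s => Wᴴ * K s * V) (fun s => Wᴴ * B s) (fun ι s => Wᴴ * N ι s * V) σ d q *ᵥ b := by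
  intro q hq
  simp only [Gmod, ← Matrix.mulVec_mulVec, gAux_mulVec]
  rw [mulVec_vtan_projection K B N V W k σ d b hK hKr hV q hq]

end StructBilin
end

section
/- Suppose C, K, B, and all N_j are analytic at ς_1,…,ς_κ ∈ ℂ and that K(ς_i) and K̂(ς_i) = Wᴴ K(ς_i) V are invertible for all i = 1,…,κ. Let c ∈ ℂ^p, let δ^{(1)},…,δ^{(κ-1)} ∈ ℂ^m, and let ν_1,…,ν_κ be nonnegative integers. Define w_{1,i} = (∂_{s^i}(cᴴ C K^{-1})(ς_κ))ᴴ for i = 0,…,ν_κ, and for 2 ≤ i ≤ κ, w_{i,j} = (∂_{s^j}(w_{i-1,ν_{κ-i+2}}ᴴ 𝔑(·,δ^{(κ-i+1)}) K^{-1})(ς_{κ-i+1}))ᴴ for j = 0,…,ν_{κ-i+1}. If all the vectors w_{i,j} lie in the column space of W, then for every 1 ≤ η ≤ κ and every i = 0,…,ν_{κ-η+1} the tangential Hermite interpolation conditions cᴴ ∂_{s_1^{i} s_2^{ν_{κ-η+2}} ⋯ s_η^{ν_κ}} 𝔾_η(ς_{κ-η+1},…,ς_κ | δ^{(κ-η+1)},…,δ^{(κ-1)})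 = cᴴ ∂_{s_1^{i} s_2^{ν_{κ-η+2}} ⋯ s_η^{ν_κ}} 𝔾̂_η(ς_{κ-η+1},…,ς_κ | δ^{(κ-η+1)},…,δ^{(κ-1)}) hold. -/
open Matrix
open scoped Kronecker

namespace StructBilin

/-! ### Analyticity of matrix-valued functions, entry by entry -/

theorem analyticAt_dotProduct {ι : Type*} [Fintype ι] {f g : ℂ → ι → ℂ} {x : ℂ}
    (hf : ∀ a, AnalyticAt ℂ (fun z => f z a) x) (hg : ∀ a, AnalyticAt ℂ (fun z => g z a) x) :
    AnalyticAt ℂ (fun z => f z ⬝ᵥ g z) x :=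
  Finset.analyticAt_fun_sum _ fun a _ => (hf a).fun_mul (hg a)

theorem analyticAt_mul_apply {α β γ : Type*} [Fintype β] {F : ℂ → Matrix α β ℂ}
    {G : ℂ → Matrix β γ ℂ} {x : ℂ} (hF : ∀ a e, AnalyticAt ℂ (fun z => F z a e) x)
    (hG : ∀ a e, AnalyticAt ℂ (fun z => G z a e) x) (a : α) (e : γ) :
    AnalyticAt ℂ (fun z => (F z * G z) a e) x :=
  analyticAt_dotProduct (hF a) fun b => hG b e

theorem analyticAt_vecMul_apply {α β : Type*} [Fintype α] {f : ℂ → α → ℂ}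
    {G : ℂ → Matrix α β ℂ} {x : ℂ} (hf : ∀ a, AnalyticAt ℂ (fun z => f z a) x)
    (hG : ∀ a e, AnalyticAt ℂ (fun z => G z a e) x) (e : β) :
    AnalyticAt ℂ (fun z => Matrix.vecMul (f z) (G z) e) x :=
  analyticAt_dotProduct hf fun a => hG a e

theorem analyticAt_det {ι : Type*} [Fintype ι] [DecidableEq ι] {F : ℂ → Matrix ι ι ℂ} {x : ℂ}
    (hF : ∀ a e, AnalyticAt ℂ (fun z => F z a e) x) :
    AnalyticAt ℂ (fun z => (F z).det) x := by
  simp only [Matrix.det_apply']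
  exact Finset.analyticAt_fun_sum _ fun τ _ =>
    analyticAt_const.fun_mul (Finset.analyticAt_fun_prod _ fun a _ => hF _ _)

theorem analyticAt_inv_apply {ι : Type*} [Fintype ι] [DecidableEq ι] {F : ℂ → Matrix ι ι ℂ}
    {x : ℂ} (hF : ∀ a e, AnalyticAt ℂ (fun z => F z a e) x) (hx : IsUnit (F x).det) (a e : ι) :
    AnalyticAt ℂ (fun z => (F z)⁻¹ a e) x := by
  simp only [Matrix.inv_def, Matrix.smul_apply, Ring.inverse_eq_inv', smul_eq_mul,
    Matrix.adjugate_apply]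
  refine ((analyticAt_det hF).fun_inv hx.ne_zero).fun_mul (analyticAt_det fun b f => ?_)
  by_cases hb : b = e
  · subst hb
    simpa using analyticAt_const
  · simpa [Matrix.updateRow_apply, hb] using hF b f

theorem eventually_isUnit_det {ι : Type*} [Fintype ι] [DecidableEq ι] {F : ℂ → Matrix ι ι ℂ}
    {x : ℂ} (hF : ∀ a e, AnalyticAt ℂ (fun z => F z a e) x) (hx : IsUnit (F x).det) :
    ∀ᶠ z in nhds x, IsUnit (F z).det := by
  filter_upwards [(analyticAt_det hF).continuousAt.eventually_ne hx.ne_zero] with z hz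
  exact isUnit_iff_ne_zero.2 hz

/-! ### Iterated derivatives of sums and products -/

theorem iteratedDeriv_dotProduct {ι : Type*} [Fintype ι] (k : ℕ) {f g : ℂ → ι → ℂ} {x : ℂ}
    (hf : ∀ a, AnalyticAt ℂ (fun z => f z a) x) (hg : ∀ a, AnalyticAt ℂ (fun z => g z a) x) :
    iteratedDeriv k (fun z => f z ⬝ᵥ g z) x =
      ∑ i ∈ Finset.range (k + 1), (k.choose i : ℂ) * (vDeriv i f x ⬝ᵥ vDeriv (k - i) g x) := by
  simp only [dotProduct]
  rw [iteratedDeriv_fun_sum fun a _ => ((hf a).fun_mul (hg a)).contDiffAt]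
  simp only [Finset.mul_sum]
  rw [Finset.sum_comm]
  refine Finset.sum_congr rfl fun a _ => ?_
  refine (iteratedDeriv_fun_mul (hf a).contDiffAt (hg a).contDiffAt).trans ?_
  exact Finset.sum_congr rfl fun i _ => mul_assoc _ _ _

theorem iteratedDeriv_const_dotProduct {ι : Type*} [Fintype ι] (k : ℕ) (u : ι → ℂ)
    {g : ℂ → ι → ℂ} {x : ℂ} (hg : ∀ a, AnalyticAt ℂ (fun z => g z a) x) :
    iteratedDeriv k (fun z => u ⬝ᵥ g z) x = u ⬝ᵥ vDeriv k g x := by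
  simp only [dotProduct]
  rw [iteratedDeriv_fun_sum fun a _ => (analyticAt_const.fun_mul (hg a)).contDiffAt]
  simp only [iteratedDeriv_const_mul_field]
  rfl

theorem iteratedDeriv_dotProduct_const {ι : Type*} [Fintype ι] (k : ℕ) (u : ι → ℂ)
    {g : ℂ → ι → ℂ} {x : ℂ} (hg : ∀ a, AnalyticAt ℂ (fun z => g z a) x) :
    iteratedDeriv k (fun z => g z ⬝ᵥ u) x = vDeriv k g x ⬝ᵥ u := by
  simp only [dotProduct_comm _ u]
  exact iteratedDeriv_const_dotProduct k u hg

theorem vDeriv_vecMul {ι γ : Type*} [Fintype ι] (k : ℕ) (u : ι → ℂ)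
    {G : ℂ → Matrix ι γ ℂ} {x : ℂ} (hG : ∀ a e, AnalyticAt ℂ (fun z => G z a e) x) :
    vDeriv k (fun z => Matrix.vecMul u (G z)) x = Matrix.vecMul u (mDeriv k G x) :=
  funext fun e => iteratedDeriv_const_dotProduct k u fun a => hG a e

/-- Derivatives of `f ⬝ᵥ g` see only the components of `g` along the columns of `W` when the
derivatives of `f` are conjugates of vectors in the column space of `W`. -/
theorem iteratedDeriv_dotProduct_congr_of_range {ι ρ : Type*} [Fintype ι] [Fintype ρ]
    (W : Matrix ι ρ ℂ) {k : ℕ} {f g₁ g₂ : ℂ → ι → ℂ} {x : ℂ}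
    (hf : ∀ a, AnalyticAt ℂ (fun z => f z a) x)
    (hg₁ : ∀ a, AnalyticAt ℂ (fun z => g₁ z a) x) (hg₂ : ∀ a, AnalyticAt ℂ (fun z => g₂ z a) x)
    (hW : ∀ j ≤ k, star (vDeriv j f x) ∈ Set.range W.mulVec)
    (hg : ∀ᶠ z in nhds x, Wᴴ *ᵥ g₁ z = Wᴴ *ᵥ g₂ z) :
    iteratedDeriv k (fun z => f z ⬝ᵥ g₁ z) x = iteratedDeriv k (fun z => f z ⬝ᵥ g₂ z) x := by
  rw [iteratedDeriv_dotProduct k hf hg₁, iteratedDeriv_dotProduct k hf hg₂]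
  refine Finset.sum_congr rfl fun i hi => ?_
  obtain ⟨u, hu⟩ := hW i (Nat.lt_succ_iff.1 (Finset.mem_range.1 hi))
  have hu' : vDeriv i f x = star u ᵥ* Wᴴ := by
    rw [← Matrix.star_mulVec, hu, star_star]
  rw [← iteratedDeriv_const_dotProduct _ _ hg₁, ← iteratedDeriv_const_dotProduct _ _ hg₂, hu']
  congr 1
  refine Filter.EventuallyEq.iteratedDeriv_eq _ ?_
  filter_upwards [hg] with z hz
  rw [← Matrix.dotProduct_mulVec, ← Matrix.dotProduct_mulVec, hz]

/-! ### Mixed partial derivatives -/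

theorem iterate_pD (t k : ℕ) (f : (ℕ → ℂ) → ℂ) (s : ℕ → ℂ) :
    (pD t)^[k] f s = iteratedDeriv k (fun z => f (Function.update s t z)) (s t) := by
  induction k generalizing s with
  | zero => simp
  | succ k ih =>
    rw [Function.iterate_succ_apply', iteratedDeriv_succ, pD]
    congr 1
    funext z
    rw [ih]
    simp

theorem mixedD_congr (ord : ℕ → ℕ) (t : ℕ) {f g : (ℕ → ℂ) → ℂ} {s : ℕ → ℂ}
    (h : ∀ s', (∀ j, t ≤ j → s' j = s j) → f s' = g s') :
    mixedD ord t f s = mixedD ord t g s := by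
  induction t generalizing f g with
  | zero => exact h s fun _ _ => rfl
  | succ t ih =>
    refine ih fun s' hs' => ?_
    rw [iterate_pD, iterate_pD]
    congr 1
    funext z
    refine h _ fun j hj => ?_
    rw [Function.update_of_ne (by omega), hs' j (by omega)]

/-- The vector `M (t-1) (s (t-1)) ⋯ M 0 (s 0) b (s 0)`. -/
noncomputable def chain {ι : Type*} [Fintype ι] (M : ℕ → ℂ → Matrix ι ι ℂ) (b : ℂ → ι → ℂ)
    (s : ℕ → ℂ) : ℕ → ι → ℂ
  | 0 => b (s 0)
  | t + 1 => M t (s t) *ᵥ chain M b s t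

theorem chain_update {ι : Type*} [Fintype ι] (M : ℕ → ℂ → Matrix ι ι ℂ) (b : ℂ → ι → ℂ)
    (s : ℕ → ℂ) {i t : ℕ} (z : ℂ) (hi : 0 < i) (ht : t ≤ i) :
    chain M b (Function.update s i z) t = chain M b s t := by
  induction t with
  | zero => simp [chain, Function.update_of_ne hi.ne]
  | succ t ih =>
    rw [chain, chain, ih (by omega), Function.update_of_ne (by omega)]

theorem mixedD_chain_zero {ι : Type*} [Fintype ι] (M : ℕ → ℂ → Matrix ι ι ℂ) (b : ℂ → ι → ℂ)
    (ord : ℕ → ℕ) (σ : ℕ → ℂ) (f : ℂ → ι → ℂ) :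
    mixedD ord 1 (fun s => f (s 0) ⬝ᵥ chain M b s 0) σ =
      iteratedDeriv (ord 0) (fun z => f z ⬝ᵥ b z) (σ 0) := by
  simp [mixedD, iterate_pD, chain]

theorem mixedD_chain_succ {ι : Type*} [Fintype ι] (M : ℕ → ℂ → Matrix ι ι ℂ) (b : ℂ → ι → ℂ)
    (ord : ℕ → ℕ) (σ : ℕ → ℂ) (t : ℕ) {f : ℂ → ι → ℂ}
    (hf : ∀ a, AnalyticAt ℂ (fun z => f z a) (σ (t + 1))) :
    mixedD ord (t + 2) (fun s => f (s (t + 1)) ⬝ᵥ chain M b s (t + 1)) σ =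
      mixedD ord (t + 1) (fun s =>
        (vDeriv (ord (t + 1)) f (σ (t + 1)) ᵥ* M t (s t)) ⬝ᵥ chain M b s t) σ := by
  rw [mixedD]
  refine mixedD_congr ord (t + 1) fun s hs => ?_
  rw [iterate_pD, hs (t + 1) le_rfl]
  simp only [Function.update_self, chain_update M b s _ (Nat.succ_pos t) le_rfl]
  rw [iteratedDeriv_dotProduct_const _ _ hf, chain, Matrix.dotProduct_mulVec]

theorem mixedD_chain_sum {ι α : Type*} [Fintype ι] [Fintype α] {M : ℕ → ℂ → Matrix ι ι ℂ}
    {b : ℂ → ι → ℂ} (ord : ℕ → ℕ) {σ : ℕ → ℂ} {t : ℕ}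
    (hM : ∀ j < t, ∀ a e, AnalyticAt ℂ (fun z => M j z a e) (σ j))
    (hb : ∀ a, AnalyticAt ℂ (fun z => b z a) (σ 0)) (u : α → ℂ) {F : ℂ → Matrix α ι ℂ}
    (hF : ∀ a e, AnalyticAt ℂ (fun z => F z a e) (σ t)) :
    ∑ a, u a * mixedD ord (t + 1) (fun s => (F (s t)).row a ⬝ᵥ chain M b s t) σ =
      mixedD ord (t + 1) (fun s => (u ᵥ* F (s t)) ⬝ᵥ chain M b s t) σ := by
  induction t generalizing F with
  | zero =>
    have hrow : ∀ a, mixedD ord 1 (fun s => (F (s 0)).row a ⬝ᵥ chain M b s 0) σ =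
        iteratedDeriv (ord 0) (fun z => (F z *ᵥ b z) a) (σ 0) :=
      fun a => mixedD_chain_zero M b ord σ fun z => (F z).row a
    simp only [Nat.zero_add, hrow]
    rw [mixedD_chain_zero M b ord σ fun z => u ᵥ* F z]
    simp only [← Matrix.dotProduct_mulVec]
    rw [iteratedDeriv_const_dotProduct (g := fun z => F z *ᵥ b z) _ _
      fun a => analyticAt_dotProduct (hF a) hb]
    rfl
  | succ t ih =>
    rw [mixedD_chain_succ M b ord σ t (f := fun z => u ᵥ* F z)
      (analyticAt_vecMul_apply (fun _ => analyticAt_const) hF), vDeriv_vecMul _ _ hF]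
    simp only [Matrix.vecMul_vecMul]
    rw [← ih (F := fun z => mDeriv (ord (t + 1)) F (σ (t + 1)) * M t z)
      (fun j hj => hM j (by omega)) (analyticAt_mul_apply (fun _ _ => analyticAt_const)
        (hM t (Nat.lt_succ_self t)))]
    refine Finset.sum_congr rfl fun a _ => ?_
    rw [mixedD_chain_succ M b ord σ t (f := fun z => (F z).row a) (hF a)]
    rfl

/-! ### Comparison of the full and the projected resolvent -/

theorem projected_resolvent {ι ρ : Type*} [Fintype ι] [Fintype ρ] [DecidableEq ρ]
    (A : Matrix ι ι ℂ) (V W : Matrix ι ρ ℂ) (h : IsUnit (Wᴴ * A * V).det) :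
    Wᴴ * (A * (V * (Wᴴ * A * V)⁻¹ * Wᴴ)) = Wᴴ := by
  rw [← Matrix.mul_assoc, ← Matrix.mul_assoc, ← Matrix.mul_assoc, Matrix.mul_nonsing_inv _ h,
    Matrix.one_mul]

theorem analyticAt_projected_resolvent {ι ρ : Type*} [Fintype ι] [Fintype ρ] [DecidableEq ρ]
    {K : ℂ → Matrix ι ι ℂ} (V W : Matrix ι ρ ℂ) {x : ℂ}
    (hK : ∀ a e, AnalyticAt ℂ (fun z => K z a e) x) (h : IsUnit (Wᴴ * K x * V).det) (a e : ι) :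
    AnalyticAt ℂ (fun z => (V * (Wᴴ * K z * V)⁻¹ * Wᴴ) a e) x := by
  have hKr : ∀ a e, AnalyticAt ℂ (fun z => (Wᴴ * K z * V) a e) x :=
    analyticAt_mul_apply (analyticAt_mul_apply (fun _ _ => analyticAt_const) hK)
      fun _ _ => analyticAt_const
  have hVK : ∀ a e, AnalyticAt ℂ (fun z => (V * (Wᴴ * K z * V)⁻¹) a e) x :=
    analyticAt_mul_apply (F := fun _ => V) (fun _ _ => analyticAt_const)
      (analyticAt_inv_apply hKr h)
  exact analyticAt_mul_apply (G := fun _ => Wᴴ) hVK (fun _ _ => analyticAt_const) a e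

/-- If the derivatives of the row function `f * K⁻¹` come from the column space of `W`, then
`f * K⁻¹ * g` and its projected counterpart have the same derivatives. -/
theorem iteratedDeriv_resolvent_eq {ι ρ : Type*} [Fintype ι] [DecidableEq ι] [Fintype ρ]
    [DecidableEq ρ] {K : ℂ → Matrix ι ι ℂ} (V W : Matrix ι ρ ℂ) {x : ℂ} {k : ℕ}
    {f g : ℂ → ι → ℂ} (hKa : ∀ a e, AnalyticAt ℂ (fun z => K z a e) x)
    (hK : IsUnit (K x).det) (hKr : IsUnit (Wᴴ * K x * V).det)
    (hf : ∀ a, AnalyticAt ℂ (fun z => f z a) x) (hg : ∀ a, AnalyticAt ℂ (fun z => g z a) x)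
    (hW : ∀ j ≤ k, star (vDeriv j (fun z => f z ᵥ* (K z)⁻¹) x) ∈ Set.range W.mulVec) :
    iteratedDeriv k (fun z => (f z ᵥ* (K z)⁻¹) ⬝ᵥ g z) x =
      iteratedDeriv k (fun z => (f z ᵥ* (V * (Wᴴ * K z * V)⁻¹ * Wᴴ)) ⬝ᵥ g z) x := by
  have hKra : ∀ a e, AnalyticAt ℂ (fun z => (Wᴴ * K z * V) a e) x :=
    analyticAt_mul_apply (analyticAt_mul_apply (fun _ _ => analyticAt_const) hKa)
      fun _ _ => analyticAt_const
  have hP : ∀ a e, AnalyticAt ℂ (fun z => (K z * (V * (Wᴴ * K z * V)⁻¹ * Wᴴ)) a e) x :=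
    analyticAt_mul_apply hKa (analyticAt_projected_resolvent V W hKa hKr)
  have hPg : ∀ a, AnalyticAt ℂ
      (fun z => ((K z * (V * (Wᴴ * K z * V)⁻¹ * Wᴴ)) *ᵥ g z) a) x :=
    fun a => analyticAt_dotProduct (hP a) hg
  rw [iteratedDeriv_dotProduct_congr_of_range W
    (analyticAt_vecMul_apply hf (analyticAt_inv_apply hKa hK)) hg hPg hW]
  · refine Filter.EventuallyEq.iteratedDeriv_eq _ ?_
    filter_upwards [eventually_isUnit_det hKa hK] with z hz
    rw [Matrix.dotProduct_mulVec, Matrix.vecMul_vecMul, ← Matrix.mul_assoc,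
      Matrix.nonsing_inv_mul _ hz, Matrix.one_mul]
  · filter_upwards [eventually_isUnit_det hKra hKr] with z hz
    rw [Matrix.mulVec_mulVec, projected_resolvent _ _ _ hz]

theorem vDeriv_resolvent_eq {ι ρ : Type*} [Fintype ι] [DecidableEq ι] [Fintype ρ]
    [DecidableEq ρ] {K : ℂ → Matrix ι ι ℂ} (V W : Matrix ι ρ ℂ) {x : ℂ} {k : ℕ}
    {f : ℂ → ι → ℂ} (hKa : ∀ a e, AnalyticAt ℂ (fun z => K z a e) x)
    (hK : IsUnit (K x).det) (hKr : IsUnit (Wᴴ * K x * V).det)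
    (hf : ∀ a, AnalyticAt ℂ (fun z => f z a) x)
    (hW : ∀ j ≤ k, star (vDeriv j (fun z => f z ᵥ* (K z)⁻¹) x) ∈ Set.range W.mulVec) :
    vDeriv k (fun z => f z ᵥ* (K z)⁻¹) x =
      vDeriv k (fun z => f z ᵥ* (V * (Wᴴ * K z * V)⁻¹ * Wᴴ)) x := by
  funext e
  simpa [vDeriv] using iteratedDeriv_resolvent_eq V W (g := fun _ => Pi.single e 1)
    hKa hK hKr hf (fun _ => analyticAt_const) hW

/-- A recursively generated family of rows `h t` whose resolvent images have derivatives in the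
column space of `W` yields equal mixed derivatives of the full and the projected chain. -/
theorem mixedD_chain_resolvent_eq {ι ρ : Type*} [Fintype ι] [DecidableEq ι] [Fintype ρ]
    [DecidableEq ρ] {K : ℂ → Matrix ι ι ℂ} (V W : Matrix ι ρ ℂ) {T : ℕ → ℂ → Matrix ι ι ℂ}
    {b : ℂ → ι → ℂ} {σ : ℕ → ℂ} {ord : ℕ → ℕ} {h : ℕ → ℂ → ι → ℂ} {t : ℕ}
    (hKa : ∀ j ≤ t, ∀ a e, AnalyticAt ℂ (fun z => K z a e) (σ j))
    (hK : ∀ j ≤ t, IsUnit (K (σ j)).det) (hKr : ∀ j ≤ t, IsUnit (Wᴴ * K (σ j) * V).det)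
    (hb : ∀ a, AnalyticAt ℂ (fun z => b z a) (σ 0))
    (hh : ∀ j ≤ t, ∀ a, AnalyticAt ℂ (fun z => h j z a) (σ j))
    (hrec : ∀ j < t, ∀ z, h j z =
      vDeriv (ord (j + 1)) (fun z => h (j + 1) z ᵥ* (K z)⁻¹) (σ (j + 1)) ᵥ* T j z)
    (hW : ∀ j ≤ t, ∀ i ≤ ord j,
      star (vDeriv i (fun z => h j z ᵥ* (K z)⁻¹) (σ j)) ∈ Set.range W.mulVec) :
    mixedD ord (t + 1) (fun s => (h t (s t) ᵥ* (K (s t))⁻¹) ⬝ᵥ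
        chain (fun j z => T j z * (K z)⁻¹) b s t) σ =
      mixedD ord (t + 1) (fun s => (h t (s t) ᵥ* (V * (Wᴴ * K (s t) * V)⁻¹ * Wᴴ)) ⬝ᵥ
        chain (fun j z => T j z * (V * (Wᴴ * K z * V)⁻¹ * Wᴴ)) b s t) σ := by
  induction t with
  | zero =>
    rw [mixedD_chain_zero _ _ _ _ fun z => h 0 z ᵥ* (K z)⁻¹,
      mixedD_chain_zero _ _ _ _ fun z => h 0 z ᵥ* (V * (Wᴴ * K z * V)⁻¹ * Wᴴ)]
    exact iteratedDeriv_resolvent_eq V W (hKa 0 le_rfl) (hK 0 le_rfl) (hKr 0 le_rfl)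
      (hh 0 le_rfl) hb (hW 0 le_rfl)
  | succ t ih =>
    have h₁ := analyticAt_vecMul_apply (hh (t + 1) le_rfl)
      (analyticAt_inv_apply (hKa (t + 1) le_rfl) (hK (t + 1) le_rfl))
    have h₂ := analyticAt_vecMul_apply (hh (t + 1) le_rfl)
      (analyticAt_projected_resolvent V W (hKa (t + 1) le_rfl) (hKr (t + 1) le_rfl))
    rw [mixedD_chain_succ _ _ _ _ _ h₁, mixedD_chain_succ _ _ _ _ _ h₂,
      ← vDeriv_resolvent_eq V W (hKa (t + 1) le_rfl) (hK (t + 1) le_rfl) (hKr (t + 1) le_rfl)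
        (hh (t + 1) le_rfl) (hW (t + 1) le_rfl)]
    have hv : ∀ z (A : Matrix ι ι ℂ), vDeriv (ord (t + 1)) (fun z => h (t + 1) z ᵥ* (K z)⁻¹) (σ (t + 1)) ᵥ*
        (T t z * A) = h t z ᵥ* A := fun z A => by
      rw [hrec t (Nat.lt_succ_self t), Matrix.vecMul_vecMul]
    simp only [hv]
    exact ih (fun j hj => hKa j (by omega)) (fun j hj => hK j (by omega))
      (fun j hj => hKr j (by omega)) (fun j hj => hh j (by omega))
      (fun j hj => hrec j (by omega)) (fun j hj => hW j (by omega))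

/-! ### Transfer functions and interpolation vectors -/

theorem gAux_apply {n m : ℕ} (K : ℂ → Matrix (Fin n) (Fin n) ℂ)
    (B : ℂ → Matrix (Fin n) (Fin m) ℂ) (N : Fin m → ℂ → Matrix (Fin n) (Fin n) ℂ)
    (s : ℕ → ℂ) (d : ℕ → Fin m → ℂ) (q : ℕ) (e : Fin m) :
    (fun a => gAux K B N s d q a e) =
      (K (s q))⁻¹ *ᵥ chain (fun j z => Nsum N z (d j) * (K z)⁻¹) (fun z a => B z a e) s q := by
  induction q with
  | zero => rfl
  | succ q ih =>
    rw [chain, ← Matrix.mulVec_mulVec, ← ih, Matrix.mulVec_mulVec]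
    rfl

theorem Nsum_projected {n m r : ℕ} (N : Fin m → ℂ → Matrix (Fin n) (Fin n) ℂ)
    (V W : Matrix (Fin n) (Fin r) ℂ) (z : ℂ) (d : Fin m → ℂ) :
    Nsum (fun ι s => Wᴴ * N ι s * V) z d = Wᴴ * Nsum N z d * V := by
  simp [Nsum, Matrix.mul_sum, Matrix.sum_mul]

theorem mulVec_gAux_projected_apply {n m r : ℕ} (K : ℂ → Matrix (Fin n) (Fin n) ℂ)
    (B : ℂ → Matrix (Fin n) (Fin m) ℂ) (N : Fin m → ℂ → Matrix (Fin n) (Fin n) ℂ)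
    (V W : Matrix (Fin n) (Fin r) ℂ) (s : ℕ → ℂ) (d : ℕ → Fin m → ℂ) (q : ℕ) (e : Fin m) :
    V *ᵥ (fun a => gAux (fun s => Wᴴ * K s * V) (fun s => Wᴴ * B s)
        (fun ι s => Wᴴ * N ι s * V) s d q a e) =
      (V * (Wᴴ * K (s q) * V)⁻¹ * Wᴴ) *ᵥ
        chain (fun j z => Nsum N z (d j) * (V * (Wᴴ * K z * V)⁻¹ * Wᴴ))
          (fun z a => B z a e) s q := by
  induction q with
  | zero =>
    rw [gAux_apply]
    simp only [chain, ← Matrix.mulVec_mulVec]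
    rfl
  | succ q ih =>
    have hstep : (fun a => gAux (fun s => Wᴴ * K s * V) (fun s => Wᴴ * B s)
        (fun ι s => Wᴴ * N ι s * V) s d (q + 1) a e) =
        ((Wᴴ * K (s (q + 1)) * V)⁻¹ * (Wᴴ * Nsum N (s q) (d q) * V)) *ᵥ
          fun a => gAux (fun s => Wᴴ * K s * V) (fun s => Wᴴ * B s)
            (fun ι s => Wᴴ * N ι s * V) s d q a e := by
      rw [← Nsum_projected]
      rfl
    rw [hstep, chain]
    simp only [← Matrix.mulVec_mulVec] at ih ⊢
    rw [ih]

theorem Gmod_apply {n m p : ℕ} (C : ℂ → Matrix (Fin p) (Fin n) ℂ)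
    (K : ℂ → Matrix (Fin n) (Fin n) ℂ) (B : ℂ → Matrix (Fin n) (Fin m) ℂ)
    (N : Fin m → ℂ → Matrix (Fin n) (Fin n) ℂ) (s : ℕ → ℂ) (d : ℕ → Fin m → ℂ) (q : ℕ)
    (a : Fin p) (e : Fin m) :
    Gmod C K B N s d q a e = (C (s q) * (K (s q))⁻¹).row a ⬝ᵥ
      chain (fun j z => Nsum N z (d j) * (K z)⁻¹) (fun z a => B z a e) s q := by
  change C (s q) a ⬝ᵥ (fun b => gAux K B N s d q b e) = _
  rw [gAux_apply, Matrix.dotProduct_mulVec]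
  rfl

theorem Gmod_projected_apply {n m p r : ℕ} (C : ℂ → Matrix (Fin p) (Fin n) ℂ)
    (K : ℂ → Matrix (Fin n) (Fin n) ℂ) (B : ℂ → Matrix (Fin n) (Fin m) ℂ)
    (N : Fin m → ℂ → Matrix (Fin n) (Fin n) ℂ) (V W : Matrix (Fin n) (Fin r) ℂ)
    (s : ℕ → ℂ) (d : ℕ → Fin m → ℂ) (q : ℕ) (a : Fin p) (e : Fin m) :
    Gmod (fun s => C s * V) (fun s => Wᴴ * K s * V) (fun s => Wᴴ * B s)
        (fun ι s => Wᴴ * N ι s * V) s d q a e =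
      (C (s q) * (V * (Wᴴ * K (s q) * V)⁻¹ * Wᴴ)).row a ⬝ᵥ
        chain (fun j z => Nsum N z (d j) * (V * (Wᴴ * K z * V)⁻¹ * Wᴴ))
          (fun z a => B z a e) s q := by
  change (C (s q) a ᵥ* V) ⬝ᵥ (fun b => gAux _ _ _ s d q b e) = _
  rw [← Matrix.dotProduct_mulVec, mulVec_gAux_projected_apply, Matrix.dotProduct_mulVec]
  rfl

theorem analyticAt_Nsum_apply {n m : ℕ} {N : Fin m → ℂ → Matrix (Fin n) (Fin n) ℂ} {x : ℂ}
    (hN : ∀ ι a e, AnalyticAt ℂ (fun z => N ι z a e) x) (d : Fin m → ℂ) (a e : Fin n) :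
    AnalyticAt ℂ (fun z => Nsum N z d a e) x := by
  simp only [Nsum, Matrix.sum_apply, Matrix.smul_apply, smul_eq_mul]
  exact Finset.analyticAt_fun_sum _ fun ι _ => analyticAt_const.fun_mul (hN ι a e)

/-- The row functions whose resolvent images generate the left Hermite vectors `wHerm`. -/
noncomputable def wRow {n m p : ℕ} (C : ℂ → Matrix (Fin p) (Fin n) ℂ)
    (K : ℂ → Matrix (Fin n) (Fin n) ℂ) (N : Fin m → ℂ → Matrix (Fin n) (Fin n) ℂ)
    (τ : ℕ → ℂ) (e : ℕ → Fin m → ℂ) (eν : ℕ → ℕ) (c : Fin p → ℂ) : ℕ → ℂ → Fin n → ℂ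
  | 0, z => star c ᵥ* C z
  | t + 1, z => star (wHerm C K N τ e eν c t (eν t)) ᵥ* Nsum N z (e t)

theorem wHerm_eq_star_vDeriv {n m p : ℕ} (C : ℂ → Matrix (Fin p) (Fin n) ℂ)
    (K : ℂ → Matrix (Fin n) (Fin n) ℂ) (N : Fin m → ℂ → Matrix (Fin n) (Fin n) ℂ)
    (τ : ℕ → ℂ) (e : ℕ → Fin m → ℂ) (eν : ℕ → ℕ) (c : Fin p → ℂ) (t j : ℕ) :
    wHerm C K N τ e eν c t j =
      star (vDeriv j (fun z => wRow C K N τ e eν c t z ᵥ* (K z)⁻¹) (τ t)) := by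
  cases t <;> simp only [wHerm, wRow, Matrix.vecMul_vecMul]

theorem stmt_4 {n m p r : ℕ} (hn : 0 < n) (hm : 0 < m) (hp : 0 < p) (hr : 0 < r)
    (C : ℂ → Matrix (Fin p) (Fin n) ℂ) (K : ℂ → Matrix (Fin n) (Fin n) ℂ)
    (B : ℂ → Matrix (Fin n) (Fin m) ℂ) (N : Fin m → ℂ → Matrix (Fin n) (Fin n) ℂ)
    (V W : Matrix (Fin n) (Fin r) ℂ)
    (κ : ℕ) (hκ : 0 < κ) (ς : ℕ → ℂ) (δ : ℕ → Fin m → ℂ) (ν : ℕ → ℕ) (c : Fin p → ℂ)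
    (hCa : ∀ i < κ, ∀ a e, AnalyticAt ℂ (fun z => C z a e) (ς i))
    (hKa : ∀ i < κ, ∀ a e, AnalyticAt ℂ (fun z => K z a e) (ς i))
    (hBa : ∀ i < κ, ∀ a e, AnalyticAt ℂ (fun z => B z a e) (ς i))
    (hNa : ∀ i < κ, ∀ ι a e, AnalyticAt ℂ (fun z => N ι z a e) (ς i))
    (hK : ∀ i < κ, IsUnit (K (ς i)).det)
    (hKr : ∀ i < κ, IsUnit (Wᴴ * K (ς i) * V).det)
    (hW : ∀ t < κ, ∀ j ≤ ν (κ - 1 - t),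
      wHerm C K N (fun t => ς (κ - 1 - t)) (fun t => δ (κ - 2 - t))
          (fun t => ν (κ - 1 - t)) c t j ∈ Set.range W.mulVec) :
    ∀ η < κ, ∀ i ≤ ν (κ - 1 - η),
      Matrix.vecMul (star c)
          (Matrix.of fun a e =>
            mixedD (fun t => if t = 0 then i else ν (κ - 1 - η + t)) (η + 1)
              (fun s => Gmod C K B N s (fun j => δ (κ - 1 - η + j)) η a e)
              (fun j => ς (κ - 1 - η + j))) =
        Matrix.vecMul (star c)
          (Matrix.of fun a e =>
            mixedD (fun t => if t = 0 then i else ν (κ - 1 - η + t)) (η + 1)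
              (fun s => Gmod (fun s => C s * V) (fun s => Wᴴ * K s * V) (fun s => Wᴴ * B s) (fun ι s => Wᴴ * N ι s * V) s (fun j => δ (κ - 1 - η + j)) η a e)
              (fun j => ς (κ - 1 - η + j))) := by
  intro η hη i hi
  set σ : ℕ → ℂ := fun j => ς (κ - 1 - η + j) with hσ
  set d : ℕ → Fin m → ℂ := fun j => δ (κ - 1 - η + j) with hd
  set ord : ℕ → ℕ := fun t => if t = 0 then i else ν (κ - 1 - η + t) with hord
  set τ : ℕ → ℂ := fun t => ς (κ - 1 - t) with hτ
  set e : ℕ → Fin m → ℂ := fun t => δ (κ - 2 - t) with he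
  set eν : ℕ → ℕ := fun t => ν (κ - 1 - t) with heν
  have hlt : ∀ j ≤ η, κ - 1 - η + j < κ := fun j hj => by omega
  have hτσ : ∀ j ≤ η, τ (η - j) = σ j := fun j hj => by
    simp only [hτ, hσ]
    congr 1
    omega
  set h : ℕ → ℂ → Fin n → ℂ := fun j => wRow C K N τ e eν c (η - j) with hh
  have hηη : h η = fun z => star c ᵥ* C z := by
    simp only [hh, Nat.sub_self]
    rfl
  have hlow : ∀ j < η, ∀ z, h j z =
      star (wHerm C K N τ e eν c (η - (j + 1)) (eν (η - (j + 1)))) ᵥ* Nsum N z (d j) := by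
    intro j hj z
    have hde : e (η - (j + 1)) = d j := by
      simp only [he, hd]
      congr 1
      omega
    have hsub : η - j = η - (j + 1) + 1 := by omega
    simp only [hh]
    rw [hsub, wRow, hde]
  have hha : ∀ j ≤ η, ∀ a, AnalyticAt ℂ (fun z => h j z a) (σ j) := by
    intro j hj
    rcases hj.eq_or_lt with rfl | hj
    · rw [hηη]
      exact analyticAt_vecMul_apply (fun _ => analyticAt_const) (hCa _ (hlt j le_rfl))
    · simp only [hlow j hj]
      exact analyticAt_vecMul_apply (fun _ => analyticAt_const)
        (analyticAt_Nsum_apply (hNa _ (hlt j hj.le)) _)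
  have hKσ : ∀ j ≤ η, ∀ a e, AnalyticAt ℂ (fun z => K z a e) (σ j) :=
    fun j hj => hKa _ (hlt j hj)
  have hrec : ∀ j < η, ∀ z, h j z =
      vDeriv (ord (j + 1)) (fun z => h (j + 1) z ᵥ* (K z)⁻¹) (σ (j + 1)) ᵥ*
        Nsum N z (d j) := by
    intro j hj z
    have hν : eν (η - (j + 1)) = ord (j + 1) := by
      simp only [heν, hord, Nat.succ_ne_zero, if_false]
      congr 1
      omega
    rw [hlow j hj, wHerm_eq_star_vDeriv, star_star, hτσ (j + 1) hj, hν]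
  have hrange : ∀ j ≤ η, ∀ k ≤ ord j,
      star (vDeriv k (fun z => h j z ᵥ* (K z)⁻¹) (σ j)) ∈ Set.range W.mulVec := by
    intro j hj k hk
    have hk' : k ≤ ν (κ - 1 - (η - j)) := by
      have hsub : κ - 1 - (η - j) = κ - 1 - η + j := by omega
      rw [hsub]
      rcases Nat.eq_zero_or_pos j with rfl | hj0
      · exact le_trans hk (by simpa [hord] using hi)
      · simpa [hord, hj0.ne'] using hk
    have hmem := hW (η - j) (by omega) k hk'
    rwa [wHerm_eq_star_vDeriv, hτσ j hj] at hmem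
  have hKi : ∀ j ≤ η, ∀ a e, AnalyticAt ℂ (fun z => (K z)⁻¹ a e) (σ j) :=
    fun j hj => analyticAt_inv_apply (hKσ j hj) (hK _ (hlt j hj))
  have hKp : ∀ j ≤ η, ∀ a e,
      AnalyticAt ℂ (fun z => (V * (Wᴴ * K z * V)⁻¹ * Wᴴ) a e) (σ j) :=
    fun j hj => analyticAt_projected_resolvent V W (hKσ j hj) (hKr _ (hlt j hj))
  have hNσ : ∀ j ≤ η, ∀ a e, AnalyticAt ℂ (fun z => Nsum N z (d j) a e) (σ j) :=
    fun j hj => analyticAt_Nsum_apply (hNa _ (hlt j hj)) _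
  have hBσ : ∀ f a, AnalyticAt ℂ (fun z => B z a f) (σ 0) :=
    fun f a => hBa _ (hlt 0 (Nat.zero_le η)) a f
  have hCσ : ∀ a e, AnalyticAt ℂ (fun z => C z a e) (σ η) := hCa _ (hlt η le_rfl)
  funext f
  have key := mixedD_chain_resolvent_eq (ord := ord) V W (T := fun j z => Nsum N z (d j)) hKσ
    (fun j hj => hK _ (hlt j hj)) (fun j hj => hKr _ (hlt j hj)) (hBσ f) hha hrec hrange
  rw [hηη] at key
  simp only [Matrix.vecMul_vecMul] at key
  have h₁ := mixedD_chain_sum ord (M := fun j z => Nsum N z (d j) * (K z)⁻¹)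
    (fun j hj => analyticAt_mul_apply (hNσ j hj.le) (hKi j hj.le)) (hBσ f) (star c)
    (analyticAt_mul_apply hCσ (hKi η le_rfl))
  have h₂ := mixedD_chain_sum ord
    (M := fun j z => Nsum N z (d j) * (V * (Wᴴ * K z * V)⁻¹ * Wᴴ))
    (fun j hj => analyticAt_mul_apply (hNσ j hj.le) (hKp j hj.le)) (hBσ f) (star c)
    (analyticAt_mul_apply hCσ (hKp η le_rfl))
  simp only [Gmod_projected_apply]
  simp only [Gmod_apply]
  exact h₁.trans (key.trans h₂.symm)

end StructBilin
end
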